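/- Let ω be a real number, let σ : ℝ → ℝ be differentiable, and let (r₁, r₂, r₃) ∈ ℝ³ with r₁² + r₂² + r₃² = 1. Define the complex-stretched coordinates x_d^σ = x_d + i σ(x_d) for d = 1, 2, 3 and the modified plane wave F^σ(x₁, x₂, x₃) = exp(i ω (r₁ x₁^σ + r₂ x₂^σ + r₃ x₃^σ)). For a function g of (x₁, x₂, x₃), let D_d g denote the stretched derivative (D_d g)(x) = (1/(1 + i σ′(x_d))) · ∂g/∂x_d (x). Then at every point x with 1 + i σ′(x_d) ≠ 0 for d = 1, 2, 3, the function F^σ satisfies −Σ_{d=1}^{3} (D_d(D_d F^σ))(x) − ω² F^σ(x) = 0. -/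

import Mathlib

open Complex

/-- The PML-stretched derivative along the first coordinate in 3D. -/
noncomputable def pmlD1 (σ : ℝ → ℝ) (g : ℝ → ℝ → ℝ → ℂ) : ℝ → ℝ → ℝ → ℂ :=
  fun x₁ x₂ x₃ => (1 + Complex.I * ((deriv σ x₁ : ℝ) : ℂ))⁻¹ * deriv (fun t => g t x₂ x₃) x₁

/-- The PML-stretched derivative along the second coordinate in 3D. -/
noncomputable def pmlD2 (σ : ℝ → ℝ) (g : ℝ → ℝ → ℝ → ℂ) : ℝ → ℝ → ℝ → ℂ :=
  fun x₁ x₂ x₃ => (1 + Complex.I * ((deriv σ x₂ : ℝ) : ℂ))⁻¹ * deriv (fun t => g x₁ t x₃) x₂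

/-- The PML-stretched derivative along the third coordinate in 3D. -/
noncomputable def pmlD3 (σ : ℝ → ℝ) (g : ℝ → ℝ → ℝ → ℂ) : ℝ → ℝ → ℝ → ℂ :=
  fun x₁ x₂ x₃ => (1 + Complex.I * ((deriv σ x₃ : ℝ) : ℂ))⁻¹ * deriv (fun t => g x₁ x₂ t) x₃

/-- The stretching factor `1 + i s` of a real slope `s` never vanishes. -/
theorem one_add_I_mul_ofReal_ne_zero (s : ℝ) : (1 : ℂ) + I * (s : ℂ) ≠ 0 := fun h => by
  simpa using congrArg Complex.re h

/-- Exponentials of the stretched coordinate are eigenfunctions of the stretched derivative. -/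
theorem stretched_deriv_exp {σ : ℝ → ℝ} {x : ℝ} (hσ : DifferentiableAt ℝ σ x) {f : ℝ → ℂ}
    (a b : ℂ) (hf : ∀ t : ℝ, f t = exp (a * ((t : ℂ) + I * (σ t : ℂ)) + b)) :
    (1 + I * ((deriv σ x : ℝ) : ℂ))⁻¹ * deriv f x = a * f x := by
  have h : HasDerivAt f (f x * (a * (1 + I * ((deriv σ x : ℝ) : ℂ)))) x := by
    rw [funext hf]
    exact ((((hasDerivAt_id x).ofReal_comp.add
      (hσ.hasDerivAt.ofReal_comp.const_mul I)).const_mul a).add_const b).cexp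
  have hne := one_add_I_mul_ofReal_ne_zero (deriv σ x)
  rw [h.deriv]
  field_simp

/-- The 3D modified plane wave `F^σ(x) = exp(i ω (r₁ x₁^σ + r₂ x₂^σ + r₃ x₃^σ))`, with
complex-stretched coordinates `x_d^σ = x_d + i σ(x_d)`, satisfies the PML-modified Helmholtz
equation `−Σ_d D_d(D_d F^σ) − ω² F^σ = 0` wherever `1 + i σ′(x_d) ≠ 0` for `d = 1, 2, 3`. -/
theorem modified_plane_wave_satisfies_pml_helmholtz_3d (ω : ℝ) (σ : ℝ → ℝ)
    (hσ : Differentiable ℝ σ) (r₁ r₂ r₃ : ℝ) (hr : r₁ ^ 2 + r₂ ^ 2 + r₃ ^ 2 = 1)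
    (Fσ : ℝ → ℝ → ℝ → ℂ)
    (hF : ∀ x₁ x₂ x₃ : ℝ, Fσ x₁ x₂ x₃ = Complex.exp (Complex.I * ω *
      ((r₁ : ℂ) * ((x₁ : ℂ) + Complex.I * (σ x₁ : ℂ)) +
       (r₂ : ℂ) * ((x₂ : ℂ) + Complex.I * (σ x₂ : ℂ)) +
       (r₃ : ℂ) * ((x₃ : ℂ) + Complex.I * (σ x₃ : ℂ)))))
    (x₁ x₂ x₃ : ℝ)
    (h1 : (1 : ℂ) + Complex.I * ((deriv σ x₁ : ℝ) : ℂ) ≠ 0)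
    (h2 : (1 : ℂ) + Complex.I * ((deriv σ x₂ : ℝ) : ℂ) ≠ 0)
    (h3 : (1 : ℂ) + Complex.I * ((deriv σ x₃ : ℝ) : ℂ) ≠ 0) :
    -(pmlD1 σ (pmlD1 σ Fσ)) x₁ x₂ x₃ - (pmlD2 σ (pmlD2 σ Fσ)) x₁ x₂ x₃
      - (pmlD3 σ (pmlD3 σ Fσ)) x₁ x₂ x₃ - (ω : ℂ) ^ 2 * Fσ x₁ x₂ x₃ = 0 := by
  have e1 : pmlD1 σ Fσ = fun y₁ y₂ y₃ => I * ω * r₁ * Fσ y₁ y₂ y₃ := by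
    funext y₁ y₂ y₃
    exact stretched_deriv_exp (hσ y₁) (I * ω * r₁)
      (I * ω * (r₂ * (y₂ + I * σ y₂) + r₃ * (y₃ + I * σ y₃)))
      fun t => by rw [hF]; ring_nf
  have e2 : pmlD2 σ Fσ = fun y₁ y₂ y₃ => I * ω * r₂ * Fσ y₁ y₂ y₃ := by
    funext y₁ y₂ y₃
    exact stretched_deriv_exp (hσ y₂) (I * ω * r₂)
      (I * ω * (r₁ * (y₁ + I * σ y₁) + r₃ * (y₃ + I * σ y₃)))
      fun t => by rw [hF]; ring_nf
  have e3 : pmlD3 σ Fσ = fun y₁ y₂ y₃ => I * ω * r₃ * Fσ y₁ y₂ y₃ := by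
    funext y₁ y₂ y₃
    exact stretched_deriv_exp (hσ y₃) (I * ω * r₃)
      (I * ω * (r₁ * (y₁ + I * σ y₁) + r₂ * (y₂ + I * σ y₂)))
      fun t => by rw [hF]; ring_nf
  have d1 : pmlD1 σ (pmlD1 σ Fσ) x₁ x₂ x₃ = I * ω * r₁ * pmlD1 σ Fσ x₁ x₂ x₃ := by
    conv_lhs => rw [e1]
    simp only [pmlD1, deriv_const_mul_field]
    ring
  have d2 : pmlD2 σ (pmlD2 σ Fσ) x₁ x₂ x₃ = I * ω * r₂ * pmlD2 σ Fσ x₁ x₂ x₃ := by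
    conv_lhs => rw [e2]
    simp only [pmlD2, deriv_const_mul_field]
    ring
  have d3 : pmlD3 σ (pmlD3 σ Fσ) x₁ x₂ x₃ = I * ω * r₃ * pmlD3 σ Fσ x₁ x₂ x₃ := by
    conv_lhs => rw [e3]
    simp only [pmlD3, deriv_const_mul_field]
    ring
  have hrc : (r₁ : ℂ) ^ 2 + (r₂ : ℂ) ^ 2 + (r₃ : ℂ) ^ 2 = 1 := by exact_mod_cast hr
  rw [d1, d2, d3, e1, e2, e3]
  linear_combination (ω : ℂ) ^ 2 * Fσ x₁ x₂ x₃ * hrc -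
    (ω : ℂ) ^ 2 * Fσ x₁ x₂ x₃ * ((r₁ : ℂ) ^ 2 + (r₂ : ℂ) ^ 2 + (r₃ : ℂ) ^ 2) * I_sq
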